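/- K is in the spectrum of the Laver ideal: there exists a Borel set B ⊆ ℕ^ℕ not belonging to the Laver ideal such that for every Borel set C ⊆ B not belonging to the Laver ideal, the restriction of K to C is Borel bireducible with K. -/

import Mathlib

open Set Filter

/-- The restriction of `x : ℕ → ℕ` to `{0,…,n-1}`, as a finite sequence. -/
def seg (x : ℕ → ℕ) (n : ℕ) : List ℕ := List.ofFn fun i : Fin n => x i

/-- `s` is the stem of the tree `T`: it belongs to `T`, is comparable with every
element of `T`, and every node of `T` extending it splits infinitely. -/
def IsStemOf (T : Set (List ℕ)) (s : List ℕ) : Prop :=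
  s ∈ T ∧ (∀ t ∈ T, t <+: s ∨ s <+: t) ∧
    ∀ t ∈ T, s <+: t → {n : ℕ | t ++ [n] ∈ T}.Infinite

/-- A Laver tree: closed under initial segments, with a stem. -/
def IsLaverTree (T : Set (List ℕ)) : Prop :=
  (∀ s ∈ T, ∀ t : List ℕ, t <+: s → t ∈ T) ∧ ∃ s, IsStemOf T s

/-- `[T]`, the set of branches of `T`. -/
def branches (T : Set (List ℕ)) : Set (ℕ → ℕ) := {x | ∀ n, seg x n ∈ T}

/-- `S ≤₀ T`: `S` is a Laver tree included in `T` with the same stem. -/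
def DirectExt (S T : Set (List ℕ)) : Prop :=
  IsLaverTree S ∧ S ⊆ T ∧ ∃ s, IsStemOf S s ∧ IsStemOf T s

/-- An (proper, containing all finite sets) ideal on ℕ. -/
def IsIdeal (I : Set (Set ℕ)) : Prop :=
  (∀ A : Set ℕ, A.Finite → A ∈ I) ∧ (∀ A B : Set ℕ, A ⊆ B → B ∈ I → A ∈ I) ∧
    (∀ A B : Set ℕ, A ∈ I → B ∈ I → A ∪ B ∈ I) ∧ (Set.univ : Set ℕ) ∉ I

/-- A P-ideal. -/
def IsPIdeal (I : Set (Set ℕ)) : Prop :=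
  ∀ A : ℕ → Set ℕ, (∀ n, A n ∈ I) → ∃ B ∈ I, ∀ n, (A n \ B).Finite

/-- Characteristic function of a subset of ℕ, as a point of the Cantor space. -/
noncomputable def chi (A : Set ℕ) : ℕ → Bool :=
  fun n => @decide (n ∈ A) (Classical.propDecidable _)

/-- An F_σ set: a countable union of closed sets. -/
def IsFsigma {X : Type*} [TopologicalSpace X] (A : Set X) : Prop :=
  ∃ F : ℕ → Set X, (∀ n, IsClosed (F n)) ∧ A = ⋃ n, F n

/-- An ideal on ℕ is F_σ if its copy in the Cantor space `ℕ → Bool` is F_σ. -/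
def FsigmaIdeal (I : Set (Set ℕ)) : Prop := IsFsigma (chi '' I)

/-- The equivalence relation `E_I` on the Cantor space induced by an ideal `I`. -/
def EI (I : Set (Set ℕ)) (x y : ℕ → Bool) : Prop := {n | x n ≠ y n} ∈ I

/-- The generator `A_g` of the Laver ideal. -/
def laverGen (g : List ℕ → ℕ) : Set (ℕ → ℕ) := {f | {n | f n < g (seg f n)}.Infinite}

/-- Membership in the Laver ideal: covered by countably many generators. -/
def InLaverIdeal (A : Set (ℕ → ℕ)) : Prop :=
  ∃ g : ℕ → List ℕ → ℕ, A ⊆ ⋃ i, laverGen (g i)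

/-- The relation `K` on the Baire space. -/
def Krel (x y : ℕ → ℕ) : Prop :=
  ∃ b : ℕ, ∀ n : ℕ, ∃ mx ≤ b, ∃ my ≤ b, x n ≤ y (n + my) ∧ y n ≤ x (n + mx)

/-- `E_{ℓ∞}` on `ℝ^ℕ`: the difference sequence is bounded. -/
def Elinf (x y : ℕ → ℝ) : Prop := ∃ C : ℝ, ∀ n, |x n - y n| ≤ C

/-- A lower semicontinuous submeasure on ℕ. -/
def IsLSCSubmeasure (μ : Set ℕ → ENNReal) : Prop :=
  μ ∅ = 0 ∧ (∀ A B : Set ℕ, A ⊆ B → μ A ≤ μ B) ∧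
    (∀ A B : Set ℕ, μ (A ∪ B) ≤ μ A + μ B) ∧
    ∀ A : Set ℕ, μ A = ⨆ n : ℕ, μ (A ∩ Set.Iio n)

/-- `Exh(μ)`. -/
def Exh (μ : Set ℕ → ENNReal) : Set (Set ℕ) :=
  {A | Filter.Tendsto (fun n : ℕ => μ (A \ Set.Iio n)) Filter.atTop (nhds 0)}

/-- `Fin(μ)`. -/
def FinSub (μ : Set ℕ → ENNReal) : Set (Set ℕ) := {A | μ A < ⊤}

section Seg

theorem seg_length (x : ℕ → ℕ) (n : ℕ) : (seg x n).length = n := by simp [seg]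

theorem seg_succ (x : ℕ → ℕ) (n : ℕ) : seg x (n + 1) = seg x n ++ [x n] := by
  rw [seg, List.ofFn_succ', List.concat_eq_append]
  rfl

theorem seg_getD {x : ℕ → ℕ} {n i : ℕ} (h : i < n) : (seg x n).getD i 0 = x i := by
  simp [seg, List.getD, h]

theorem seg_eq_seg_iff {x y : ℕ → ℕ} {n : ℕ} : seg x n = seg y n ↔ ∀ i < n, x i = y i := by
  constructor
  · intro h i hi
    rw [← seg_getD (x := x) hi, h, seg_getD hi]
  · intro h
    simp only [seg]
    congr 1
    funext i
    exact h i i.2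

theorem seg_take (x : ℕ → ℕ) {m n : ℕ} (h : m ≤ n) : (seg x n).take m = seg x m := by
  induction n, h using Nat.le_induction with
  | base => exact List.take_of_length_le (seg_length x m).le
  | succ n hn ih =>
    rw [seg_succ, List.take_append_of_le_length (by rw [seg_length]; exact hn), ih]

theorem seg_length_eq_iff {x : ℕ → ℕ} {l : List ℕ} :
    seg x l.length = l ↔ ∀ i < l.length, x i = l.getD i 0 := by
  constructor
  · intro h i hi
    rw [← seg_getD (x := x) hi, h]
  · intro h
    refine List.ext_getElem (seg_length _ _) fun i h₁ h₂ => ?_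
    have := h i h₂
    rw [List.getD_eq_getElem _ _ h₂] at this
    rw [← this]
    simp [seg]

/-- An increasing chain of finite sequences of unbounded length converges. -/
theorem exists_seg_eq_of_chain (l : ℕ → List ℕ) (hl : ∀ i, l i <+: l (i + 1))
    (hu : ∀ n, ∃ i, n < (l i).length) : ∃ x, ∀ i, seg x (l i).length = l i := by
  have mono : ∀ i j, i ≤ j → l i <+: l j := by
    intro i j h
    induction j, h using Nat.le_induction with
    | base => exact List.prefix_rfl
    | succ j _ ih => exact ih.trans (hl j)
  have key : ∀ i j n, i ≤ j → n < (l i).length → (l i).getD n 0 = (l j).getD n 0 := by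
    intro i j n h hn
    obtain ⟨t, ht⟩ := mono i j h
    rw [← ht, List.getD_append _ _ _ _ hn]
  choose a ha using hu
  refine ⟨fun n => (l (a n)).getD n 0, fun i => seg_length_eq_iff.2 fun n hn => ?_⟩
  rcases le_total i (a n) with h | h
  · exact (key _ _ n h hn).symm
  · exact key _ _ n h (ha n)

/-- Continuous maps on the Baire space are determined locally by finite restrictions. -/
theorem exists_seg_determines {π : (ℕ → ℕ) → (ℕ → ℕ)} (hπ : Continuous π) (y : ℕ → ℕ) (n : ℕ) :
    ∃ m, ∀ z, seg z m = seg y m → π z n = π y n := by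
  have ho : IsOpen {z | π z n = π y n} :=
    (isOpen_discrete {π y n}).preimage ((continuous_apply n).comp hπ)
  obtain ⟨I, u, hu, hs⟩ := isOpen_pi_iff.1 ho y rfl
  refine ⟨I.sup id + 1, fun z hz => hs fun i hi => ?_⟩
  rw [seg_eq_seg_iff.1 hz i (Nat.lt_succ_of_le (Finset.le_sup (f := id) hi))]
  exact (hu i hi).2

theorem measurable_of_finite_dependence (f : (ℕ → ℕ) → ℕ) (m : ℕ)
    (h : ∀ x y, (∀ i < m, x i = y i) → f x = f y) : Measurable f := by
  have hf : f = (fun v : Fin m → ℕ => f fun i => if h : i < m then v ⟨i, h⟩ else 0) ∘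
      (fun x i => x i) := by
    funext x
    exact h _ _ fun i hi => by simp [hi]
  rw [hf]
  exact (measurable_of_countable _).comp (measurable_pi_lambda _ fun i => measurable_pi_apply _)

end Seg

section Positive

/-- `A` is positive at the node `s`: every bounding function is respected above `s` by some
element of `A` through `s`. -/
def PositiveAt (s : List ℕ) (A : Set (ℕ → ℕ)) : Prop :=
  ∀ g : List ℕ → ℕ, ∃ f ∈ A, seg f s.length = s ∧ ∀ n ≥ s.length, g (seg f n) ≤ f n

theorem exists_uniform_bound (A : Set (ℕ → ℕ)) :
    ∃ Γ : List ℕ → ℕ, ∀ f ∈ A, ∀ m, (∀ n ≥ m, Γ (seg f n) ≤ f n) → PositiveAt (seg f m) A := by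
  have h : ∀ t : List ℕ, ∃ γ : List ℕ → ℕ, ¬ PositiveAt t A →
      ∀ f ∈ A, seg f t.length = t → ∃ n ≥ t.length, f n < γ (seg f n) := by
    intro t
    by_cases ht : PositiveAt t A
    · exact ⟨fun _ => 0, fun h => absurd ht h⟩
    · unfold PositiveAt at ht
      push Not at ht
      obtain ⟨γ, hγ⟩ := ht
      exact ⟨γ, fun _ => hγ⟩
  choose γ hγ using h
  refine ⟨fun t => (Finset.range (t.length + 1)).sup fun i => γ (t.take i) t, fun f hf m hm => ?_⟩
  by_contra hp
  obtain ⟨n, hn, hlt⟩ := hγ _ hp f hf (by rw [seg_length])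
  rw [seg_length] at hn
  have h₁ := hm n hn
  beta_reduce at h₁
  have h₂ := Finset.le_sup (s := Finset.range ((seg f n).length + 1))
    (f := fun i => γ ((seg f n).take i) (seg f n)) (b := m)
    (Finset.mem_range.2 (by rw [seg_length]; omega))
  simp only [seg_take f hn] at h₂
  omega

theorem exists_positiveAt_of_not_inLaverIdeal {C : Set (ℕ → ℕ)} (hC : ¬ InLaverIdeal C) :
    ∃ s, PositiveAt s C := by
  obtain ⟨Γ, hΓ⟩ := exists_uniform_bound C
  by_contra hno
  push Not at hno
  refine hC ⟨fun _ => Γ, fun f hf => mem_iUnion.2 ⟨0, ?_⟩⟩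
  by_contra hfin
  obtain ⟨m, hm⟩ := (not_infinite.1 hfin).bddAbove
  refine hno _ (hΓ f hf (m + 1) fun n hn => ?_)
  by_contra hlt
  have := hm (show n ∈ {n | f n < Γ (seg f n)} from not_le.1 hlt)
  omega

theorem PositiveAt.exists_append {s : List ℕ} {A : Set (ℕ → ℕ)} (h : PositiveAt s A) (k : ℕ) :
    ∃ n ≥ k, PositiveAt (s ++ [n]) A := by
  obtain ⟨Γ, hΓ⟩ := exists_uniform_bound A
  obtain ⟨f, hf, hs, hr⟩ := h fun t => max k (Γ t)
  refine ⟨f s.length, le_trans (le_max_left _ _) (hr _ le_rfl), ?_⟩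
  have := hΓ f hf (s.length + 1) fun n hn => le_trans (le_max_right _ _) (hr n (by omega))
  rwa [seg_succ, hs] at this

/-- A strategy for reaching `D` from a node, where at each step the new entry can be made to
exceed any prescribed bound. -/
inductive ReachStrategy (D : List ℕ → Prop) : List ℕ → Type
  | hit (s : List ℕ) (h : D s) : ReachStrategy D s
  | step (s : List ℕ) (next : ℕ → ℕ) (le_next : ∀ k, k ≤ next k)
      (rest : ∀ k, ReachStrategy D (s ++ [next k])) : ReachStrategy D s

theorem PositiveAt.nonempty_reachStrategy {s : List ℕ} {A : Set (ℕ → ℕ)} (h : PositiveAt s A)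
    (B : ℕ → Set (ℕ → ℕ)) (hB : A ⊆ ⋃ v, B v) :
    Nonempty (ReachStrategy (fun t => ∃ v, PositiveAt t (B v)) s) := by
  by_contra hne
  set D : List ℕ → Prop := fun t => ∃ v, PositiveAt t (B v) with hD
  choose Γ hΓ using fun v => exists_uniform_bound (B v)
  have hstep : ∀ t, ∃ k, ¬ Nonempty (ReachStrategy D t) →
      ∀ n ≥ k, ¬ Nonempty (ReachStrategy D (t ++ [n])) := by
    intro t
    by_contra hcon
    push Not at hcon
    choose h₁ next hnext h₂ using hcon
    exact (h₁ 0).false (.step t next hnext fun k => (h₂ k).some)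
  choose bd hbd using hstep
  obtain ⟨f, hf, hs, hr⟩ := h fun t =>
    max (bd t) ((Finset.range (t.length + 1)).sup fun v => Γ v t)
  have hempty : ∀ n ≥ s.length, ¬ Nonempty (ReachStrategy D (seg f n)) := by
    intro n hn
    induction n, hn using Nat.le_induction with
    | base => rwa [hs]
    | succ n hn ih =>
      rw [seg_succ]
      exact hbd _ ih _ (le_trans (le_max_left _ _) (hr n hn))
  obtain ⟨v, hv⟩ := mem_iUnion.1 (hB hf)
  refine hempty (max v s.length) (le_max_right _ _) ⟨.hit _ ⟨v, hΓ v f hv _ fun n hn => ?_⟩⟩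
  have h₁ := hr n (le_trans (le_max_right _ _) hn)
  have h₂ := Finset.le_sup (s := Finset.range ((seg f n).length + 1))
    (f := fun v => Γ v (seg f n)) (b := v)
    (Finset.mem_range.2 (by rw [seg_length]; have := le_max_left v s.length; omega))
  exact h₂.trans ((le_max_right _ _).trans h₁)

end Positive

section Game

/-- The image under `π` of the cylinder given by `u`. -/
def cylinderImage (π : (ℕ → ℕ) → (ℕ → ℕ)) (u : List ℕ) : Set (ℕ → ℕ) :=
  π '' {y | seg y u.length = u}

theorem cylinderImage_subset_iUnion (π : (ℕ → ℕ) → (ℕ → ℕ)) (u : List ℕ) :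
    cylinderImage π u ⊆ ⋃ v, cylinderImage π (u ++ [v]) := by
  rintro _ ⟨y, hy, rfl⟩
  refine mem_iUnion.2 ⟨y u.length, y, ?_, rfl⟩
  have hy' : seg y u.length = u := hy
  simp [seg_succ, hy']

theorem cylinderImage_append_subset (π : (ℕ → ℕ) → (ℕ → ℕ)) (u : List ℕ) (v : ℕ) :
    cylinderImage π (u ++ [v]) ⊆ cylinderImage π u := by
  rintro _ ⟨y, hy, rfl⟩
  refine ⟨y, ?_, rfl⟩
  have hy' : seg y (u ++ [v]).length = u ++ [v] := hy
  rw [List.length_append, List.length_singleton, seg_succ] at hy'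
  exact (List.append_inj' hy' rfl).1

/-- A position in the game: a part `u` of the witness, a node `s`, and a strategy for reaching
a node at which the witness can be prolonged. -/
structure Position (π : (ℕ → ℕ) → (ℕ → ℕ)) where
  witness : List ℕ
  node : List ℕ
  strategy : ReachStrategy (fun t => ∃ v, PositiveAt t (cylinderImage π (witness ++ [v]))) node

variable {π : (ℕ → ℕ) → (ℕ → ℕ)}

theorem exists_position {u s : List ℕ} (h : PositiveAt s (cylinderImage π u)) :
    ∃ p : Position π, p.witness = u ∧ p.node = s :=
  ⟨⟨u, s, (h.nonempty_reachStrategy _ (cylinderImage_subset_iUnion π u)).some⟩, rfl, rfl⟩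

theorem exists_position_of_hit {u s : List ℕ}
    (h : ∃ v, PositiveAt s (cylinderImage π (u ++ [v]))) (k : ℕ) :
    ∃ p : Position π, (∃ v, p.witness = u ++ [v]) ∧ ∃ n ≥ k, p.node = s ++ [n] := by
  obtain ⟨v, hv⟩ := h
  obtain ⟨n, hn, hp⟩ := hv.exists_append k
  obtain ⟨p, h₁, h₂⟩ := exists_position hp
  exact ⟨p, ⟨v, h₁⟩, n, hn, h₂⟩

/-- The position following `p` when the next entry is required to be at least `k`. -/
noncomputable def Position.move (p : Position π) (k : ℕ) : Position π :=
  match p with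
  | ⟨_, _, .hit _ h⟩ => (exists_position_of_hit h k).choose
  | ⟨u, _, .step _ _ _ rest⟩ => ⟨u, _, rest k⟩

theorem Position.move_node (p : Position π) (k : ℕ) :
    ∃ n ≥ k, (p.move k).node = p.node ++ [n] := by
  obtain ⟨u, s, S⟩ := p
  cases S with
  | hit _ h => exact (exists_position_of_hit h k).choose_spec.2
  | step _ next hn rest => exact ⟨next k, hn k, rfl⟩

theorem Position.move_witness (p : Position π) (k : ℕ) : p.witness <+: (p.move k).witness := by
  obtain ⟨u, s, S⟩ := p
  cases S with
  | hit _ h =>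
    obtain ⟨v, hv⟩ := (exists_position_of_hit h k).choose_spec.1
    exact ⟨[v], hv.symm⟩
  | step _ next hn rest => exact List.prefix_rfl

theorem Position.exists_mem (p : Position π) :
    ∃ f ∈ cylinderImage π p.witness, seg f p.node.length = p.node := by
  obtain ⟨u, s, S⟩ := p
  simp only
  induction S with
  | hit s h =>
    obtain ⟨v, hv⟩ := h
    obtain ⟨f, hf, hs, -⟩ := hv fun _ => 0
    exact ⟨f, cylinderImage_append_subset π u v hf, hs⟩
  | step s next _ rest ih =>
    obtain ⟨f, hf, hs⟩ := ih 0
    refine ⟨f, hf, ?_⟩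
    rw [List.length_append, List.length_singleton, seg_succ] at hs
    exact (List.append_inj' hs rfl).1

theorem Position.exists_witness_lt {q : ℕ → Position π} {κ : ℕ → ℕ}
    (hq : ∀ i, q (i + 1) = (q i).move (κ i)) (i : ℕ) :
    ∃ j > i, (q i).witness.length < (q j).witness.length := by
  have key : ∀ (u s : List ℕ)
      (S : ReachStrategy (fun t => ∃ v, PositiveAt t (cylinderImage π (u ++ [v]))) s) (i : ℕ),
      q i = ⟨u, s, S⟩ → ∃ j > i, u.length < (q j).witness.length := by
    intro u s S
    induction S with
    | hit s h =>
      intro i hi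
      refine ⟨i + 1, Nat.lt_succ_self i, ?_⟩
      obtain ⟨v, hv⟩ := (exists_position_of_hit h (κ i)).choose_spec.1
      rw [hq, hi]
      change u.length < (exists_position_of_hit h (κ i)).choose.witness.length
      rw [hv]
      simp
    | step s next _ rest ih =>
      intro i hi
      obtain ⟨j, hj, hlt⟩ := ih (κ i) (i + 1) (by rw [hq, hi]; rfl)
      exact ⟨j, by omega, hlt⟩
  exact key _ _ _ i rfl

/-- The sequence of states produced by the bounds `κ`. -/
def gameRun {S : Type} (move : S → ℕ → S) (q₀ : S) (κ : ℕ → ℕ) : ℕ → S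
  | 0 => q₀
  | i + 1 => move (gameRun move q₀ κ i) (κ i)

/-- An analytic set outside the Laver ideal admits a strategy which answers arbitrary lower
bounds on the successive entries, from some node on, by producing an element of the set. -/
theorem exists_laver_strategy {C : Set (ℕ → ℕ)} (hC : MeasureTheory.AnalyticSet C)
    (hL : ¬ InLaverIdeal C) :
    ∃ (S : Type) (q₀ : S) (move : S → ℕ → S) (node : S → List ℕ),
      (∀ q k, ∃ n ≥ k, node (move q k) = node q ++ [n]) ∧
      ∀ κ x, (∀ i, seg x (node (gameRun move q₀ κ i)).length = node (gameRun move q₀ κ i)) →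
        x ∈ C := by
  obtain ⟨s, hs⟩ := exists_positiveAt_of_not_inLaverIdeal hL
  rw [MeasureTheory.AnalyticSet] at hC
  rcases hC with rfl | ⟨π, hπ, rfl⟩
  · obtain ⟨f, hf, -⟩ := hs fun _ => 0
    exact absurd hf (notMem_empty f)
  have hs' : PositiveAt s (cylinderImage π []) := by
    convert hs using 1
    simp [cylinderImage, seg]
  obtain ⟨q₀, -, -⟩ := exists_position hs'
  refine ⟨Position π, q₀, Position.move, Position.node, Position.move_node, fun κ x hx => ?_⟩
  set q := gameRun Position.move q₀ κ with hqdef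
  have hq : ∀ i, q (i + 1) = (q i).move (κ i) := fun i => rfl
  have hpre : ∀ i, (q i).witness <+: (q (i + 1)).witness := fun i => by
    rw [hq]; exact Position.move_witness _ _
  have hmono : Monotone fun i => (q i).witness.length :=
    monotone_nat_of_le_succ fun i => (hpre i).length_le
  have hunb : ∀ n, ∃ i, n < (q i).witness.length := by
    intro n
    induction n with
    | zero =>
      obtain ⟨j, -, hj⟩ := Position.exists_witness_lt hq 0
      exact ⟨j, by omega⟩
    | succ n ih =>
      obtain ⟨i, hi⟩ := ih
      obtain ⟨j, -, hj⟩ := Position.exists_witness_lt hq i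
      exact ⟨j, by omega⟩
  have hnode : ∀ i, i ≤ (q i).node.length := by
    intro i
    induction i with
    | zero => exact Nat.zero_le _
    | succ i ih =>
      obtain ⟨n, -, hn⟩ := Position.move_node (q i) (κ i)
      rw [hq, hn]
      simpa using ih
  obtain ⟨y, hy⟩ := exists_seg_eq_of_chain (fun i => (q i).witness) hpre hunb
  refine ⟨y, funext fun n => ?_⟩
  obtain ⟨m, hm⟩ := exists_seg_determines hπ y n
  obtain ⟨i, hi⟩ := hunb m
  set j := max i (n + 1)
  have hmj : m ≤ (q j).witness.length := hi.le.trans (hmono (le_max_left i (n + 1)))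
  have hnj : n < (q j).node.length := lt_of_lt_of_le (le_max_right i (n + 1)) (hnode j)
  obtain ⟨_, ⟨z, hz, rfl⟩, hf⟩ := (q j).exists_mem
  have hz' : seg z (q j).witness.length = (q j).witness := hz
  have h₁ : π z n = π y n := by
    apply hm
    rw [← seg_take z hmj, ← seg_take y hmj, hz', hy j]
  have h₂ : π z n = x n := seg_eq_seg_iff.1 (hf.trans (hx j).symm) n hnj
  rw [← h₁, h₂]

end Game

section Embedding

/-- The states that can be reached with bounds among the first `r` scales, and the `r`-th
scale. -/
def scaleAux {S : Type} (move : S → ℕ → S) (val : S → ℕ → ℕ) (q₀ : S) : ℕ → List S × ℕ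
  | 0 => ([q₀], 0)
  | r + 1 =>
    let p := scaleAux move val q₀ r
    (p.1 ++ p.1.map fun q => move q p.2, p.2 + (p.1.map fun q => val q p.2).sum + 1)

/-- An analytic set outside the Laver ideal contains a measurable copy of the strictly increasing
sequences, in which entries are compared by means of a scale `N`. -/
theorem exists_scaled_embedding {C : Set (ℕ → ℕ)} (hC : MeasureTheory.AnalyticSet C)
    (hL : ¬ InLaverIdeal C) :
    ∃ (G : (ℕ → ℕ) → (ℕ → ℕ)) (N : ℕ → ℕ) (L : ℕ), Measurable G ∧ Monotone N ∧
      (∀ r, G r ∈ C) ∧ (∀ r r', ∀ i < L, G r i = G r' i) ∧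
      ∀ r, StrictMono r → ∀ i, N (r i) ≤ G r (L + i) ∧ G r (L + i) < N (r i + 1) := by
  obtain ⟨S, q₀, move, node, hmove, hmem⟩ := exists_laver_strategy hC hL
  choose val hle hval using hmove
  set N : ℕ → ℕ := fun r => (scaleAux move val q₀ r).2 with hN
  have hNmono : Monotone N := monotone_nat_of_le_succ fun r => by
    simp only [hN, scaleAux]; omega
  have hlist : ∀ r r', r ≤ r' → (scaleAux move val q₀ r).1 ⊆ (scaleAux move val q₀ r').1 := by
    intro r r' h
    induction r', h using Nat.le_induction with
    | base => exact List.Subset.refl _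
    | succ r' _ ih => exact List.Subset.trans ih (List.subset_append_left _ _)
  have hvalN : ∀ r, ∀ q ∈ (scaleAux move val q₀ r).1, val q (N r) < N (r + 1) := by
    intro r q hq
    have := List.le_sum_of_mem
      (List.mem_map_of_mem (f := fun q => val q (scaleAux move val q₀ r).2) hq)
    simp only [hN, scaleAux]
    omega
  have hlen : ∀ κ i, (node (gameRun move q₀ κ i)).length = (node q₀).length + i := by
    intro κ i
    induction i with
    | zero => rfl
    | succ i ih => rw [gameRun, hval, List.length_append, ih, List.length_singleton, add_assoc]
  have hlim : ∀ κ, ∃ x,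
      ∀ i, seg x (node (gameRun move q₀ κ i)).length = node (gameRun move q₀ κ i) := fun κ =>
    exists_seg_eq_of_chain (fun i => node (gameRun move q₀ κ i))
      (fun i => ⟨[_], (hval _ _).symm⟩) fun n => ⟨n + 1, by rw [hlen]; omega⟩
  choose F hF using hlim
  have hdep : ∀ κ κ' i, (∀ j < i, κ j = κ' j) → gameRun move q₀ κ i = gameRun move q₀ κ' i := by
    intro κ κ' i h
    induction i with
    | zero => rfl
    | succ i ih => rw [gameRun, gameRun, ih fun j hj => h j (by omega), h i (Nat.lt_succ_self i)]
  have hagree : ∀ κ κ' i, gameRun move q₀ κ i = gameRun move q₀ κ' i →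
      ∀ n < (node q₀).length + i, F κ n = F κ' n := by
    intro κ κ' i h n hn
    have h₁ := hF κ i
    have h₂ := hF κ' i
    rw [← h, ← h₁, seg_length, hlen] at h₂
    exact (seg_eq_seg_iff.1 h₂ n hn).symm
  have hentry : ∀ κ i, F κ ((node q₀).length + i) = val (gameRun move q₀ κ i) (κ i) := by
    intro κ i
    have h₁ := hF κ (i + 1)
    rw [hlen, ← add_assoc, seg_succ, gameRun, hval] at h₁
    have h₂ := (List.append_inj' h₁ rfl).2
    simpa using h₂
  refine ⟨fun r => F fun i => N (r i), N, (node q₀).length, ?_, hNmono, fun r => hmem _ _ (hF _),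
    fun r r' i hi => hagree (fun i => N (r i)) (fun i => N (r' i)) 0 rfl i hi, ?_⟩
  · refine measurable_pi_lambda _ fun n => measurable_of_finite_dependence _ (n + 1) ?_
    intro x y h
    exact hagree _ _ (n + 1) (hdep _ _ _ fun j hj => by rw [h j hj]) n (by omega)
  · intro r hr i
    beta_reduce
    rw [hentry]
    refine ⟨hle _ _, hvalN _ _ ?_⟩
    induction i with
    | zero => exact hlist 0 (r 0) (Nat.zero_le _) (List.mem_singleton_self q₀)
    | succ i ih =>
      refine hlist (r i + 1) (r (i + 1)) (hr (Nat.lt_succ_self i)) ?_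
      exact List.mem_append_right _ (List.mem_map_of_mem (f := fun q => move q (N (r i))) ih)

theorem krel_iff_of_scale {G : (ℕ → ℕ) → (ℕ → ℕ)} {N : ℕ → ℕ} {L : ℕ} (hN : Monotone N)
    (hlow : ∀ r r', ∀ i < L, G r i = G r' i)
    (hG : ∀ r, StrictMono r → ∀ i, N (r i) ≤ G r (L + i) ∧ G r (L + i) < N (r i + 1))
    {r r' : ℕ → ℕ} (hr : StrictMono r) (hr' : StrictMono r') :
    Krel r r' ↔ Krel (G r) (G r') := by
  have up : ∀ {r r' : ℕ → ℕ}, StrictMono r → StrictMono r' → ∀ i m, r i ≤ r' (i + m) →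
      G r (L + i) ≤ G r' (L + i + (m + 1)) := by
    intro r r' hr hr' i m h
    have h₁ := (hG r hr i).2
    have h₂ := (hG r' hr' (i + m + 1)).1
    have h₃ : r i + 1 ≤ r' (i + m + 1) := lt_of_le_of_lt h (hr' (Nat.lt_succ_self _))
    have h₄ := hN h₃
    rw [show L + i + (m + 1) = L + (i + m + 1) by omega]
    omega
  have down : ∀ {r r' : ℕ → ℕ}, StrictMono r → StrictMono r' → ∀ i m,
      G r (L + i) ≤ G r' (L + i + m) → r i ≤ r' (i + m) := by
    intro r r' hr hr' i m h
    have h₁ := (hG r hr i).1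
    have h₂ := (hG r' hr' (i + m)).2
    rw [add_assoc] at h
    exact Nat.lt_succ_iff.1 (hN.reflect_lt (lt_of_le_of_lt (h₁.trans h) h₂))
  constructor
  · rintro ⟨b, hb⟩
    refine ⟨b + 1, fun n => ?_⟩
    rcases lt_or_ge n L with hn | hn
    · exact ⟨0, Nat.zero_le _, 0, Nat.zero_le _, (hlow r r' n hn).le, (hlow r' r n hn).le⟩
    · obtain ⟨i, rfl⟩ := Nat.exists_eq_add_of_le hn
      obtain ⟨mx, hmx, my, hmy, h₁, h₂⟩ := hb i
      exact ⟨mx + 1, by omega, my + 1, by omega, up hr hr' i my h₁, up hr' hr i mx h₂⟩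
  · rintro ⟨b, hb⟩
    refine ⟨b, fun n => ?_⟩
    obtain ⟨mx, hmx, my, hmy, h₁, h₂⟩ := hb (L + n)
    exact ⟨mx, hmx, my, hmy, down hr hr' n my h₁, down hr' hr n mx h₂⟩

end Embedding

section Approximation

/-- The restriction of the relation `K` with constant `b` to the first `k` entries. -/
def KrelUpTo (k b : ℕ) (x y : ℕ → ℕ) : Prop :=
  ∀ n, n + b < k → ∃ mx ≤ b, ∃ my ≤ b, x n ≤ y (n + my) ∧ y n ≤ x (n + mx)

theorem KrelUpTo.symm {k b : ℕ} {x y : ℕ → ℕ} (h : KrelUpTo k b x y) : KrelUpTo k b y x := by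
  intro n hn
  obtain ⟨mx, hmx, my, hmy, h₁, h₂⟩ := h n hn
  exact ⟨my, hmy, mx, hmx, h₂, h₁⟩

theorem KrelUpTo.mono {k b c : ℕ} {x y : ℕ → ℕ} (h : KrelUpTo k b x y) (hbc : b ≤ c) :
    KrelUpTo k c x y := by
  intro n hn
  obtain ⟨mx, hmx, my, hmy, h₁⟩ := h n (by omega)
  exact ⟨mx, by omega, my, by omega, h₁⟩

theorem KrelUpTo.trans {k b c : ℕ} {x y z : ℕ → ℕ} (h : KrelUpTo k b x y)
    (h' : KrelUpTo k c y z) : KrelUpTo k (b + c) x z := by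
  intro n hn
  obtain ⟨-, -, my, hmy, h₁, -⟩ := h n (by omega)
  obtain ⟨-, -, mz, hmz, h₂, -⟩ := h' (n + my) (by omega)
  obtain ⟨my', hmy', -, -, -, h₃⟩ := h' n (by omega)
  obtain ⟨mx, hmx, -, -, -, h₄⟩ := h (n + my') (by omega)
  rw [add_assoc] at h₂ h₄
  exact ⟨my' + mx, by omega, my + mz, by omega, h₁.trans h₂, h₃.trans h₄⟩

theorem KrelUpTo.of_agree {k b : ℕ} {x x' y : ℕ → ℕ} (h : KrelUpTo k b x y)
    (hx : ∀ i < k, x i = x' i) : KrelUpTo k b x' y := by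
  intro n hn
  obtain ⟨mx, hmx, my, hmy, h₁⟩ := h n hn
  refine ⟨mx, hmx, my, hmy, ?_⟩
  rwa [← hx n (by omega), ← hx (n + mx) (by omega)]

theorem krel_iff_exists_forall_krelUpTo {x y : ℕ → ℕ} :
    Krel x y ↔ ∃ b, ∀ k, KrelUpTo k b x y :=
  exists_congr fun b => ⟨fun h _ n _ => h n, fun h n => h (n + b + 1) n (Nat.lt_succ_self _)⟩

/-- The least constant `b` for which `KrelUpTo k b x y` holds. -/
noncomputable def kdist (k : ℕ) (x y : ℕ → ℕ) : ℕ := sInf {b | KrelUpTo k b x y}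

theorem krelUpTo_self_bound (k : ℕ) (x y : ℕ → ℕ) : KrelUpTo k k x y := fun n hn => by omega

theorem krelUpTo_kdist (k : ℕ) (x y : ℕ → ℕ) : KrelUpTo k (kdist k x y) x y :=
  Nat.sInf_mem (s := {b | KrelUpTo k b x y}) ⟨k, krelUpTo_self_bound k x y⟩

theorem kdist_le {k b : ℕ} {x y : ℕ → ℕ} (h : KrelUpTo k b x y) : kdist k x y ≤ b :=
  Nat.sInf_le h

/-- The distances from `x` to all finite sequences. -/
noncomputable def kprofile (x : ℕ → ℕ) (j : ℕ) : ℕ :=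
  kdist (Denumerable.ofNat (List ℕ) j).length x fun i => (Denumerable.ofNat (List ℕ) j).getD i 0

theorem kprofile_le (x : ℕ → ℕ) (j : ℕ) :
    kprofile x j ≤ (Denumerable.ofNat (List ℕ) j).length :=
  kdist_le (krelUpTo_self_bound _ _ _)

theorem measurable_kprofile : Measurable kprofile := by
  refine measurable_pi_lambda _ fun j => measurable_of_finite_dependence _
    (Denumerable.ofNat (List ℕ) j).length fun x y h => ?_
  refine congrArg sInf (Set.ext fun b => ?_)
  rw [mem_ofPred_eq, mem_ofPred_eq]
  exact ⟨fun hb => hb.of_agree h, fun hb => hb.of_agree fun i hi => (h i hi).symm⟩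

theorem krel_iff_kprofile {x y : ℕ → ℕ} :
    Krel x y ↔ ∃ b, ∀ j, kprofile x j ≤ kprofile y j + b ∧ kprofile y j ≤ kprofile x j + b := by
  rw [krel_iff_exists_forall_krelUpTo]
  refine exists_congr fun b => ⟨fun h j => ⟨?_, ?_⟩, fun h k => ?_⟩
  · rw [add_comm]
    exact kdist_le ((h _).trans (krelUpTo_kdist _ _ _))
  · rw [add_comm]
    exact kdist_le ((h _).symm.trans (krelUpTo_kdist _ _ _))
  · have hj := (h (Encodable.encode (seg x k))).2
    simp only [kprofile, Denumerable.ofNat_encode, seg_length] at hj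
    have hagree : ∀ i < k, (seg x k).getD i 0 = x i := fun i hi => seg_getD hi
    have h₀ : kdist k x (fun i => (seg x k).getD i 0) ≤ 0 := kdist_le fun n hn =>
      ⟨0, le_rfl, 0, le_rfl, (hagree n hn).ge, (hagree n hn).le⟩
    have h₁ := (krelUpTo_kdist k y fun i => (seg x k).getD i 0).mono (c := b) (by omega)
    exact h₁.symm.of_agree hagree

end Approximation

section Encoding

/-- The beginning of the `j`-th block, when the `i`-th block has length `c i + 1`. -/
def blockStart (c : ℕ → ℕ) (j : ℕ) : ℕ := j + ∑ i ∈ Finset.range j, c i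

theorem blockStart_mono (c : ℕ → ℕ) : Monotone (blockStart c) :=
  monotone_nat_of_le_succ fun j => by simp only [blockStart, Finset.sum_range_succ]; omega

theorem blockStart_add_lt (c : ℕ → ℕ) {i j : ℕ} (h : i < j) :
    blockStart c i + c i < blockStart c j := by
  have := blockStart_mono c (Nat.succ_le_of_lt h)
  simp only [blockStart, Nat.succ_eq_add_one, Finset.sum_range_succ] at this ⊢
  omega

/-- A strictly increasing sequence which jumps in the `j`-th block, with delay `z j`. -/
def jumpSeq (c z : ℕ → ℕ) (n : ℕ) : ℕ :=
  n + ∑ j ∈ Finset.range (n + 1), if blockStart c j + z j ≤ n then c j else 0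

theorem jumpSeq_le_jumpSeq {c z z' : ℕ → ℕ} {b : ℕ} (h : ∀ j, z' j ≤ z j + b) (n : ℕ) :
    jumpSeq c z n ≤ jumpSeq c z' (n + b) := by
  refine add_le_add (Nat.le_add_right n b) ?_
  refine (Finset.sum_le_sum fun j _ => ?_).trans
    (Finset.sum_le_sum_of_subset (Finset.range_subset_range.2 (by omega)))
  have := h j
  split_ifs <;> omega

theorem strictMono_jumpSeq (c z : ℕ → ℕ) : StrictMono (jumpSeq c z) := by
  refine strictMono_nat_of_lt_succ fun n => add_lt_add_of_lt_of_le (Nat.lt_succ_self n) ?_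
  refine (Finset.sum_le_sum fun j _ => ?_).trans
    (Finset.sum_le_sum_of_subset (Finset.range_subset_range.2 (by omega)))
  split_ifs <;> omega

theorem measurable_jumpSeq (c : ℕ → ℕ) : Measurable (jumpSeq c) := by
  refine measurable_pi_lambda _ fun n => measurable_of_finite_dependence _ (n + 1) fun x y h => ?_
  refine congrArg (n + ·) (Finset.sum_congr rfl fun j hj => ?_)
  rw [h j (Finset.mem_range.1 hj)]

theorem le_add_of_jumpSeq_le {c z z' : ℕ → ℕ} {b : ℕ} (hz : ∀ j, z j ≤ c j) (hz' : ∀ j, z' j ≤ c j)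
    (h : ∀ n, ∃ m ≤ b, jumpSeq c z n ≤ jumpSeq c z' (n + m)) (j : ℕ) : z' j ≤ z j + b := by
  by_contra hlt
  obtain ⟨m, hm, hle⟩ := h (blockStart c j + z j)
  set n := blockStart c j + z j with hn
  have hjn : j ≤ n := by simp only [hn, blockStart]; omega
  have low : ∑ i ∈ Finset.range (j + 1), c i ≤
      ∑ i ∈ Finset.range (n + 1), if blockStart c i + z i ≤ n then c i else 0 := by
    refine (Finset.sum_le_sum fun i hi => ?_).trans
      (Finset.sum_le_sum_of_subset (Finset.range_subset_range.2 (by omega)))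
    rw [if_pos]
    rcases Nat.lt_succ_iff_lt_or_eq.1 (Finset.mem_range.1 hi) with hij | rfl
    · have := blockStart_add_lt c hij
      have := hz i
      omega
    · exact le_rfl
  have high : (∑ i ∈ Finset.range (n + m + 1),
      if blockStart c i + z' i ≤ n + m then c i else 0) ≤ ∑ i ∈ Finset.range j, c i := by
    rw [← Finset.sum_filter]
    refine Finset.sum_le_sum_of_subset fun i hi => ?_
    have hi' := (Finset.mem_filter.1 hi).2
    rw [Finset.mem_range]
    by_contra hji
    rcases Nat.lt_or_eq_of_le (not_lt.1 hji) with hji | rfl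
    · have := blockStart_add_lt c hji
      have := hz' j
      omega
    · omega
  simp only [jumpSeq] at hle
  rw [Finset.sum_range_succ] at low
  have := hz' j
  omega

theorem krel_jumpSeq_iff {c z z' : ℕ → ℕ} (hz : ∀ j, z j ≤ c j) (hz' : ∀ j, z' j ≤ c j) :
    Krel (jumpSeq c z) (jumpSeq c z') ↔ ∃ b, ∀ j, z j ≤ z' j + b ∧ z' j ≤ z j + b := by
  constructor
  · rintro ⟨b, hb⟩
    refine ⟨b, fun j => ⟨le_add_of_jumpSeq_le hz' hz (fun n => ?_) j,
      le_add_of_jumpSeq_le hz hz' (fun n => ?_) j⟩⟩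
    · obtain ⟨mx, hmx, -, -, -, h⟩ := hb n
      exact ⟨mx, hmx, h⟩
    · obtain ⟨-, -, my, hmy, h, -⟩ := hb n
      exact ⟨my, hmy, h⟩
  · rintro ⟨b, hb⟩
    exact ⟨b, fun n => ⟨b, le_rfl, b, le_rfl, jumpSeq_le_jumpSeq (fun j => (hb j).2) n,
      jumpSeq_le_jumpSeq (fun j => (hb j).1) n⟩⟩

/-- `K` reduces to its restriction to strictly increasing sequences. -/
theorem exists_reduction_to_strictMono :
    ∃ R : (ℕ → ℕ) → (ℕ → ℕ), Measurable R ∧ (∀ x, StrictMono (R x)) ∧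
      ∀ x y, Krel x y ↔ Krel (R x) (R y) :=
  ⟨fun x => jumpSeq (fun j => (Denumerable.ofNat (List ℕ) j).length) (kprofile x),
    (measurable_jumpSeq _).comp measurable_kprofile, fun _ => strictMono_jumpSeq _ _,
    fun x y => krel_iff_kprofile.trans (krel_jumpSeq_iff (kprofile_le x) (kprofile_le y)).symm⟩

end Encoding

theorem not_inLaverIdeal_univ : ¬ InLaverIdeal univ := by
  rintro ⟨g, hg⟩
  set top : List ℕ → ℕ := fun t => (Finset.range (t.length + 1)).sup fun i => g i t with htop
  set l : ℕ → List ℕ := fun n => Nat.rec [] (fun _ t => t ++ [top t]) n with hl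
  have hseg : ∀ n, seg (fun n => top (l n)) n = l n := by
    intro n
    induction n with
    | zero => rfl
    | succ n ih => rw [seg_succ, ih]
  obtain ⟨i, hi⟩ := mem_iUnion.1 (hg (mem_univ fun n => top (l n)))
  refine hi ((finite_Iio i).subset fun n hn => ?_)
  by_contra hni
  have hn' : top (l n) < g i (seg (fun n => top (l n)) n) := hn
  rw [← hseg n] at hn'
  have h₂ := Finset.le_sup
    (s := Finset.range ((seg (fun n => top (l n)) n).length + 1))
    (f := fun i => g i (seg (fun n => top (l n)) n)) (b := i)
    (Finset.mem_range.2 (by rw [seg_length]; simp only [mem_Iio] at hni; omega))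
  exact absurd hn' (not_lt.2 (by rw [hseg n] at h₂ ⊢; exact h₂))

/-- `K` is in the spectrum of the Laver ideal. -/
theorem stmt6 :
    ∃ B : Set (ℕ → ℕ), MeasurableSet B ∧ ¬ InLaverIdeal B ∧
      ∀ C : Set (ℕ → ℕ), C ⊆ B → MeasurableSet C → ¬ InLaverIdeal C →
        ((∃ f : (ℕ → ℕ) → (ℕ → ℕ), Measurable f ∧
            ∀ x ∈ C, ∀ y ∈ C, (Krel x y ↔ Krel (f x) (f y))) ∧
          (∃ g : (ℕ → ℕ) → (ℕ → ℕ), Measurable g ∧ (∀ x, g x ∈ C) ∧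
            ∀ x y, (Krel x y ↔ Krel (g x) (g y)))) := by
  refine ⟨univ, MeasurableSet.univ, not_inLaverIdeal_univ, fun C _ hC hL =>
    ⟨⟨id, measurable_id, fun _ _ _ _ => Iff.rfl⟩, ?_⟩⟩
  obtain ⟨R, hR, hmono, hred⟩ := exists_reduction_to_strictMono
  obtain ⟨G, N, L, hG, hN, hGC, hlow, hscale⟩ := exists_scaled_embedding hC.analyticSet hL
  exact ⟨G ∘ R, hG.comp hR, fun x => hGC _, fun x y =>
    (hred x y).trans (krel_iff_of_scale hN hlow hscale (hmono x) (hmono y))⟩
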